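/- Fix 0 < q < 1, θ > 0 and the contour C_{θ,π/4} parametrized by W(s) = log_q(q^θ + |s| e^{i(π/4) sgn(s)}). For any integer j ≥ 1 such that Re[q^{W+j} - q^θ] ≥ 0 (i.e. W+j lies between C_{θ,π/4} and C_{θ,π/2}), the function X ↦ Re[f_0(W + X)] is decreasing for X ∈ (0, j); consequently Re[f_0(W) - f_0(W+j)] ≥ 0. -/

import Mathlib

open Complex Real

/-- The infinite q-Pochhammer symbol `(a; q)_∞ = ∏_{k=0}^∞ (1 - a q^k)`. -/
noncomputable def qPoch (a q : ℂ) : ℂ := ∏' k : ℕ, (1 - a * q ^ k)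

/-- The q-Gamma function `Γ_q(z) = (1-q)^{1-z} (q;q)_∞ / (q^z;q)_∞`. -/
noncomputable def qGamma (q : ℝ) (z : ℂ) : ℂ :=
  ((1 - q : ℂ)) ^ ((1 : ℂ) - z) * qPoch (q : ℂ) (q : ℂ) / qPoch ((q : ℂ) ^ z) (q : ℂ)

/-- The q-digamma function `Ψ_q(z) = d/dz log Γ_q(z)`. -/
noncomputable def qDigamma (q : ℝ) (z : ℂ) : ℂ :=
  deriv (fun w => Complex.log (qGamma q w)) z

/-- `κ(q,θ) = Ψ'_q(θ) / ((log q)^2 q^θ)`. -/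
noncomputable def kappaC (q θ : ℝ) : ℂ :=
  deriv (qDigamma q) (θ : ℂ) / (((Real.log q : ℂ)) ^ 2 * (q : ℂ) ^ (θ : ℂ))

/-- `f(q,θ) = Ψ'_q(θ)/(log q)^2 - Ψ_q(θ)/log q - log(1-q)/log q`. -/
noncomputable def fC (q θ : ℝ) : ℂ :=
  deriv (qDigamma q) (θ : ℂ) / ((Real.log q : ℂ)) ^ 2
    - qDigamma q (θ : ℂ) / (Real.log q : ℂ)
    - (Real.log (1 - q) : ℂ) / (Real.log q : ℂ)

/-- `f₀(Z) = -f (log q) Z + κ q^Z + log((q^Z; q)_∞)`. -/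
noncomputable def f0 (q θ : ℝ) (Z : ℂ) : ℂ :=
  -fC q θ * (Real.log q : ℂ) * Z + kappaC q θ * (q : ℂ) ^ Z
    + Complex.log (qPoch ((q : ℂ) ^ Z) (q : ℂ))

/-- The contour `C_{θ,π/4}`, parametrized by `W(s) = log_q (q^θ + |s| e^{i(π/4) sgn s})`. -/
noncomputable def Wc (q θ : ℝ) (s : ℝ) : ℂ :=
  Complex.log ((q : ℂ) ^ (θ : ℂ) +
    (|s| : ℝ) * Complex.exp (Complex.I * ((Real.pi / 4) * Real.sign s))) / (Real.log q : ℂ)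

theorem summable_pow_div_one_sub_mul_pow (q : ℝ) (hq0 : 0 < q) (hq1 : q < 1) (a : ℂ) (n : ℕ) :
    Summable fun k : ℕ => (q : ℂ) ^ k / (1 - a * (q : ℂ) ^ k) ^ n := by
  have hqn : ‖(q : ℂ)‖ < 1 := by simpa [abs_of_pos hq0] using hq1
  have hlim : Filter.Tendsto (fun k : ℕ => ((1 - a * (q : ℂ) ^ k) ^ n)⁻¹) Filter.atTop
      (nhds ((1 - a * 0) ^ n)⁻¹) :=
    (((tendsto_pow_atTop_nhds_zero_of_norm_lt_one hqn).const_mul a).const_sub 1 |>.pow n).inv₀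
      (by simp)
  have hO := (Asymptotics.isBigO_refl (fun k : ℕ => (q : ℂ) ^ k) Filter.atTop).mul
    (hlim.isBigO_one ℂ)
  refine summable_of_isBigO_nat (g := fun k : ℕ => q ^ k)
    (summable_geometric_of_lt_one hq0.le hq1) ?_
  refine Asymptotics.IsBigO.trans (by simpa [div_eq_mul_inv] using! hO) ?_
  refine Asymptotics.isBigO_of_le _ fun k => ?_
  simp

theorem qPoch_ne_zero (q : ℝ) (hq0 : 0 < q) (hq1 : q < 1) (a : ℂ)
    (ha : ∀ k : ℕ, 1 - a * (q : ℂ) ^ k ≠ 0) : qPoch a q ≠ 0 := by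
  unfold qPoch
  simp_rw [sub_eq_add_neg] at ha ⊢
  refine tprod_one_add_ne_zero_of_summable (f := fun k : ℕ => -(a * (q : ℂ) ^ k)) ha ?_
  simpa [abs_of_pos hq0] using (summable_geometric_of_lt_one hq0.le hq1).mul_left ‖a‖

theorem hasDerivAt_qPoch (q : ℝ) (hq0 : 0 < q) (hq1 : q < 1) (a : ℂ)
    (ha : ∀ k : ℕ, 1 - a * (q : ℂ) ^ k ≠ 0) :
    HasDerivAt (fun w => qPoch w q)
      (-qPoch a q * ∑' k : ℕ, (q : ℂ) ^ k / (1 - a * (q : ℂ) ^ k)) a := by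
  set U : Set ℂ := Metric.ball 0 (‖a‖ + 1)
  have haU : a ∈ U := by simp [U]
  have hm : MultipliableLocallyUniformlyOn (fun (k : ℕ) (w : ℂ) => 1 - w * (q : ℂ) ^ k) U := by
    simp_rw [sub_eq_add_neg]
    refine ((summable_geometric_of_lt_one hq0.le hq1).mul_left
      (‖a‖ + 1)).multipliableLocallyUniformlyOn_nat_one_add Metric.isOpen_ball
      (.of_forall fun k w hw => ?_) (fun k => by fun_prop)
    have hwle : ‖w‖ ≤ ‖a‖ + 1 := by simpa [U] using (Metric.mem_ball.1 hw).le
    simp only [norm_neg, norm_mul, norm_pow, norm_real, Real.norm_eq_abs, abs_of_pos hq0]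
    gcongr
  have hterm (k : ℕ) : logDeriv (fun w : ℂ => 1 - w * (q : ℂ) ^ k) a =
      -((q : ℂ) ^ k / (1 - a * (q : ℂ) ^ k)) := by
    have : HasDerivAt (fun w : ℂ => 1 - w * (q : ℂ) ^ k) (-(1 * (q : ℂ) ^ k)) a :=
      ((hasDerivAt_id a).mul_const _).const_sub 1
    rw [logDeriv_apply, this.deriv]
    ring
  have hd : DifferentiableOn ℂ (fun w => qPoch w q) U :=
    hm.hasProdLocallyUniformlyOn.differentiableOn
      (.of_forall fun _ => by simpa [Finset.prod_fn] using
        DifferentiableOn.finsetProd (fun _ _ => by fun_prop)) Metric.isOpen_ball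
  have hne := qPoch_ne_zero q hq0 hq1 a ha
  have hlog : logDeriv (fun w => qPoch w q) a =
      -∑' k : ℕ, (q : ℂ) ^ k / (1 - a * (q : ℂ) ^ k) := by
    have h := logDeriv_tprod_eq_tsum (f := fun (k : ℕ) (w : ℂ) => 1 - w * (q : ℂ) ^ k)
      Metric.isOpen_ball haU ha (fun k => by fun_prop)
      (by
        simp_rw [hterm]
        simpa using (summable_pow_div_one_sub_mul_pow q hq0 hq1 a 1).neg) hm hne
    simp_rw [hterm, tsum_neg] at h
    exact h
  have h := (hd.differentiableAt (Metric.isOpen_ball.mem_nhds haU)).hasDerivAt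
  rw [logDeriv_apply, div_eq_iff hne] at hlog
  rw [hlog] at h
  exact h.congr_deriv (by ring)

theorem one_sub_mul_pow_ne_zero (q : ℝ) (hq0 : 0 < q) (hq1 : q < 1) (a : ℂ) (ha : ‖a‖ < 1)
    (k : ℕ) : 1 - a * (q : ℂ) ^ k ≠ 0 := by
  intro h
  have h1 : ‖a * (q : ℂ) ^ k‖ = 1 := by rw [← sub_eq_zero.1 h]; simp
  have h2 : ‖a * (q : ℂ) ^ k‖ ≤ ‖a‖ * 1 := by
    simp only [norm_mul, norm_pow, norm_real, Real.norm_eq_abs, abs_of_pos hq0]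
    gcongr
    exact pow_le_one₀ hq0.le hq1.le
  linarith

theorem hasDerivAt_tsum_lambert (q : ℝ) (hq0 : 0 < q) (hq1 : q < 1) (a : ℂ) (ha : ‖a‖ < 1) :
    HasDerivAt (fun w : ℂ => w * ∑' k : ℕ, (q : ℂ) ^ k / (1 - w * (q : ℂ) ^ k))
      (∑' k : ℕ, (q : ℂ) ^ k / (1 - a * (q : ℂ) ^ k) ^ 2) a := by
  obtain ⟨r, har, hr1⟩ := exists_between ha
  set U : Set ℂ := Metric.ball 0 r
  have haU : a ∈ U := by simpa [U] using har
  have hUne (w : ℂ) (hw : w ∈ U) (k : ℕ) : 1 - w * (q : ℂ) ^ k ≠ 0 :=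
    one_sub_mul_pow_ne_zero q hq0 hq1 w (lt_trans (by simpa [U] using hw) hr1) k
  have hdiff (k : ℕ) : DifferentiableOn ℂ
      (fun w : ℂ => w * ((q : ℂ) ^ k / (1 - w * (q : ℂ) ^ k))) U := by
    intro w hw
    exact DifferentiableWithinAt.mul (by fun_prop)
      (DifferentiableWithinAt.div (by fun_prop) (by fun_prop) (hUne w hw k))
  have hsum : Summable fun k : ℕ => q ^ k / (1 - r) :=
    (summable_geometric_of_lt_one hq0.le hq1).div_const _
  have hle (k : ℕ) (w : ℂ) (hw : w ∈ U) :
      ‖w * ((q : ℂ) ^ k / (1 - w * (q : ℂ) ^ k))‖ ≤ q ^ k / (1 - r) := by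
    have hwr : ‖w‖ < r := by simpa [U] using hw
    have hqk : q ^ k ≤ 1 := pow_le_one₀ hq0.le hq1.le
    have hqk0 : 0 < q ^ k := by positivity
    have hlow : 1 - r ≤ ‖1 - w * (q : ℂ) ^ k‖ := by
      have h := norm_sub_norm_le (1 : ℂ) (w * (q : ℂ) ^ k)
      simp only [norm_one, norm_mul, norm_pow, norm_real, Real.norm_eq_abs, abs_of_pos hq0] at h
      nlinarith [norm_nonneg w]
    have h1r : 0 < 1 - r := by linarith
    rw [norm_mul, norm_div, norm_pow, norm_real, Real.norm_eq_abs, abs_of_pos hq0]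
    calc ‖w‖ * (q ^ k / ‖1 - w * (q : ℂ) ^ k‖) ≤ 1 * (q ^ k / (1 - r)) := by
          gcongr
          linarith
      _ = _ := one_mul _
  have hterm (k : ℕ) : deriv (fun w : ℂ => w * ((q : ℂ) ^ k / (1 - w * (q : ℂ) ^ k))) a =
      (q : ℂ) ^ k / (1 - a * (q : ℂ) ^ k) ^ 2 := by
    have h1 : HasDerivAt (fun w : ℂ => 1 - w * (q : ℂ) ^ k) (-(1 * (q : ℂ) ^ k)) a :=
      ((hasDerivAt_id a).mul_const _).const_sub 1
    have h2 := (hasDerivAt_id a).mul ((hasDerivAt_const a ((q : ℂ) ^ k)).div h1 (hUne a haU k))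
    have hne := hUne a haU k
    refine Eq.trans h2.deriv ?_
    simp only [id, Pi.div_apply]
    field_simp
    ring
  have hs := hasSum_deriv_of_summable_norm hsum hdiff Metric.isOpen_ball hle haU
  have hd := (differentiableOn_tsum_of_summable_norm hsum hdiff Metric.isOpen_ball
    hle).differentiableAt (Metric.isOpen_ball.mem_nhds haU) |>.hasDerivAt
  simp_rw [hterm] at hs
  rw [← hs.tsum_eq] at hd
  simpa only [tsum_mul_left] using hd

theorem norm_ofReal_cpow_lt_one (q : ℝ) (hq0 : 0 < q) (hq1 : q < 1) (z : ℂ) (hz : 0 < z.re) :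
    ‖(q : ℂ) ^ z‖ < 1 := by
  rw [norm_cpow_eq_rpow_re_of_pos hq0]
  exact Real.rpow_lt_one hq0.le hq1 hz

theorem hasDerivAt_const_ofReal_cpow (q : ℝ) (hq0 : 0 < q) (z : ℂ) :
    HasDerivAt (fun w : ℂ => (q : ℂ) ^ w) ((q : ℂ) ^ z * (Real.log q : ℂ)) z := by
  have h := (hasDerivAt_id z).const_cpow (c := (q : ℂ)) (Or.inl (by exact_mod_cast hq0.ne'))
  simpa [ofReal_log hq0.le] using h

theorem qPoch_ofReal (q t : ℝ) (hq0 : 0 < q) (hq1 : q < 1) (ht0 : 0 < t) (ht1 : t < 1) :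
    ∃ p : ℝ, 0 < p ∧ qPoch (t : ℂ) q = p := by
  have hpos (k : ℕ) : 0 < 1 - t * q ^ k := by
    have := pow_le_one₀ (n := k) hq0.le hq1.le
    nlinarith
  have hs : Summable fun k : ℕ => Real.log (1 + -(t * q ^ k)) :=
    Real.summable_log_one_add_of_summable
      ((summable_geometric_of_lt_one hq0.le hq1).mul_left t).neg
  refine ⟨Real.exp (∑' k : ℕ, Real.log (1 - t * q ^ k)), Real.exp_pos _, ?_⟩
  have hlog (k : ℕ) : Complex.log (1 - (t : ℂ) * (q : ℂ) ^ k) =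
      (Real.log (1 + -(t * q ^ k)) : ℂ) := by
    rw [← sub_eq_add_neg, ofReal_log (hpos k).le]
    push_cast
    rfl
  have h := cexp_tsum_eq_tprod (f := fun k : ℕ => 1 - (t : ℂ) * (q : ℂ) ^ k)
    (fun k => by exact_mod_cast (hpos k).ne')
    (by simp_rw [hlog]; exact_mod_cast hs)
  simp_rw [hlog, ← ofReal_tsum, ← ofReal_exp] at h
  simpa [qPoch, sub_eq_add_neg] using h.symm

theorem hasDerivAt_qGamma (q : ℝ) (hq0 : 0 < q) (hq1 : q < 1) (z : ℂ) (hz : 0 < z.re) :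
    HasDerivAt (qGamma q) (qGamma q z * (-(Real.log (1 - q) : ℂ) + (Real.log q : ℂ) *
      ((q : ℂ) ^ z * ∑' k : ℕ, (q : ℂ) ^ k / (1 - (q : ℂ) ^ z * (q : ℂ) ^ k)))) z := by
  have hne := one_sub_mul_pow_ne_zero q hq0 hq1 _ (norm_ofReal_cpow_lt_one q hq0 hq1 z hz)
  have hP0 := qPoch_ne_zero q hq0 hq1 _ hne
  have hP : HasDerivAt (fun w : ℂ => qPoch ((q : ℂ) ^ w) q) _ z :=
    (hasDerivAt_qPoch q hq0 hq1 _ hne).comp z (hasDerivAt_const_ofReal_cpow q hq0 z)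
  have h1q : 0 < 1 - q := by linarith
  have hE : HasDerivAt (fun w : ℂ => (1 - q : ℂ) ^ ((1 : ℂ) - w)) _ z :=
    (((hasDerivAt_id z).const_sub 1)).const_cpow
      (Or.inl (by exact_mod_cast h1q.ne'))
  have h := (hE.mul_const (qPoch (q : ℂ) q)).div hP hP0
  refine h.congr_deriv ?_
  have hlog : Complex.log (1 - q : ℂ) = (Real.log (1 - q) : ℂ) := by
    rw [ofReal_log h1q.le]; push_cast; rfl
  rw [hlog]
  unfold qGamma
  simp only [id]
  field_simp
  ring

theorem qGamma_mem_slitPlane (q θ : ℝ) (hq0 : 0 < q) (hq1 : q < 1) (hθ : 0 < θ) :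
    qGamma q (θ : ℂ) ∈ slitPlane := by
  have h1q : 0 < 1 - q := by linarith
  obtain ⟨p, hp, hpc⟩ := qPoch_ofReal q (q ^ θ) hq0 hq1 (Real.rpow_pos_of_pos hq0 _)
    (Real.rpow_lt_one hq0.le hq1 hθ)
  obtain ⟨c, hc, hcc⟩ := qPoch_ofReal q q hq0 hq1 hq0 hq1
  have : qGamma q (θ : ℂ) = (((1 - q) ^ (1 - θ) * c / p : ℝ) : ℂ) := by
    unfold qGamma
    rw [← ofReal_cpow hq0.le, hpc, hcc]
    push_cast [ofReal_cpow h1q.le]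
    rfl
  rw [this, ofReal_mem_slitPlane]
  have := Real.rpow_pos_of_pos h1q (1 - θ)
  positivity

theorem qDigamma_eventuallyEq (q θ : ℝ) (hq0 : 0 < q) (hq1 : q < 1) (hθ : 0 < θ) :
    qDigamma q =ᶠ[nhds (θ : ℂ)] fun z => -(Real.log (1 - q) : ℂ) + (Real.log q : ℂ) *
      ((q : ℂ) ^ z * ∑' k : ℕ, (q : ℂ) ^ k / (1 - (q : ℂ) ^ z * (q : ℂ) ^ k)) := by
  have hre : ∀ᶠ z : ℂ in nhds (θ : ℂ), 0 < z.re :=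
    (isOpen_lt continuous_const continuous_re).mem_nhds (by simpa using hθ)
  have hs := (hasDerivAt_qGamma q hq0 hq1 θ (by simpa using hθ)).continuousAt.eventually_mem
    (isOpen_slitPlane.mem_nhds (qGamma_mem_slitPlane q θ hq0 hq1 hθ))
  filter_upwards [hre, hs] with z hz hzs
  have h := (hasDerivAt_qGamma q hq0 hq1 z hz).clog hzs
  unfold qDigamma
  rw [h.deriv, mul_div_cancel_left₀ _ (slitPlane_ne_zero hzs)]

theorem deriv_qDigamma (q θ : ℝ) (hq0 : 0 < q) (hq1 : q < 1) (hθ : 0 < θ) :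
    deriv (qDigamma q) (θ : ℂ) = (Real.log q : ℂ) ^ 2 * ((q : ℂ) ^ (θ : ℂ) *
      ∑' k : ℕ, (q : ℂ) ^ k / (1 - (q : ℂ) ^ (θ : ℂ) * (q : ℂ) ^ k) ^ 2) := by
  rw [(qDigamma_eventuallyEq q θ hq0 hq1 hθ).deriv_eq]
  have h1 := (hasDerivAt_tsum_lambert q hq0 hq1 _
    (norm_ofReal_cpow_lt_one q hq0 hq1 θ (by simpa using hθ))).comp (θ : ℂ)
    (hasDerivAt_const_ofReal_cpow q hq0 θ)
  refine Eq.trans ((h1.const_mul (Real.log q : ℂ)).const_add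
    (-(Real.log (1 - q) : ℂ))).deriv ?_
  ring

theorem kappaC_eq_tsum (q θ : ℝ) (hq0 : 0 < q) (hq1 : q < 1) (hθ : 0 < θ) :
    kappaC q θ = ∑' k : ℕ, (q : ℂ) ^ k / (1 - (q : ℂ) ^ (θ : ℂ) * (q : ℂ) ^ k) ^ 2 := by
  have hl : (Real.log q : ℂ) ≠ 0 := by exact_mod_cast (Real.log_neg hq0 hq1).ne
  have ht : (q : ℂ) ^ (θ : ℂ) ≠ 0 := by
    rw [← ofReal_cpow hq0.le]; exact_mod_cast (Real.rpow_pos_of_pos hq0 _).ne'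
  rw [kappaC, deriv_qDigamma q θ hq0 hq1 hθ]
  field_simp

theorem fC_eq_tsum (q θ : ℝ) (hq0 : 0 < q) (hq1 : q < 1) (hθ : 0 < θ) :
    fC q θ = (q : ℂ) ^ (θ : ℂ) *
        ∑' k : ℕ, (q : ℂ) ^ k / (1 - (q : ℂ) ^ (θ : ℂ) * (q : ℂ) ^ k) ^ 2
      - (q : ℂ) ^ (θ : ℂ) *
        ∑' k : ℕ, (q : ℂ) ^ k / (1 - (q : ℂ) ^ (θ : ℂ) * (q : ℂ) ^ k) := by
  have hl : (Real.log q : ℂ) ≠ 0 := by exact_mod_cast (Real.log_neg hq0 hq1).ne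
  rw [fC, deriv_qDigamma q θ hq0 hq1 hθ, (qDigamma_eventuallyEq q θ hq0 hq1 hθ).eq_of_nhds]
  field_simp
  ring

theorem hasDerivAt_log_norm {F : ℝ → ℂ} {dF : ℂ} {x : ℝ} (hF : HasDerivAt F dF x)
    (h0 : F x ≠ 0) : HasDerivAt (fun y => Real.log ‖F y‖) (dF / F x).re x := by
  have h := (hF.norm_sq.log (by simpa using h0)).div_const 2
  have hn : ‖F x‖ ≠ 0 := by simpa using h0
  refine (h.congr_of_eventuallyEq (.of_forall fun y => ?_)).congr_deriv ?_
  · simp [Real.log_pow]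
  · simp only [Complex.inner, div_re, mul_re, conj_re, conj_im, ← normSq_eq_norm_sq]
    have : normSq (F x) ≠ 0 := by simpa using h0
    field_simp
    ring

theorem hasDerivAt_re_f0 (q θ : ℝ) (hq0 : 0 < q) (hq1 : q < 1) (W : ℂ) (X : ℝ)
    (hne : ∀ k : ℕ, 1 - (q : ℂ) ^ (W + X) * (q : ℂ) ^ k ≠ 0) :
    HasDerivAt (fun X : ℝ => (f0 q θ (W + X)).re)
      (Real.log q * (-fC q θ + kappaC q θ * (q : ℂ) ^ (W + X) - (q : ℂ) ^ (W + X) *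
        ∑' k : ℕ, (q : ℂ) ^ k / (1 - (q : ℂ) ^ (W + X) * (q : ℂ) ^ k)).re) X := by
  have hP0 := qPoch_ne_zero q hq0 hq1 _ hne
  have hpath : HasDerivAt (fun X : ℝ => W + (X : ℂ)) 1 X := by
    simpa using (ofRealCLM.hasDerivAt (x := X)).const_add W
  have hpow := (hasDerivAt_const_ofReal_cpow q hq0 (W + X)).comp X hpath
  have hP := (hasDerivAt_qPoch q hq0 hq1 _ hne).comp X hpow
  have h1 := hasDerivAt_log_norm hP hP0
  have h2 := (hpath.const_mul (-fC q θ * (Real.log q : ℂ))).add (hpow.const_mul (kappaC q θ))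
  have h3 := (reCLM.hasFDerivAt.comp_hasDerivAt X h2).add h1
  refine (h3.congr_of_eventuallyEq (.of_forall fun Y => ?_)).congr_deriv ?_
  · simp [f0, log_re]
  · rw [← re_ofReal_mul]
    simp only [reCLM_apply, ← add_re, Function.comp_def]
    congr 1
    field_simp
    ring

theorem re_sq_div_nonpos (u t : ℝ) (w : ℂ) (hu : 0 ≤ u) (htu : 0 ≤ 1 - t * u)
    (h0 : 0 ≤ w.re - t) (h1 : w.re - t ≤ |w.im|) :
    ((w - t) ^ 2 / (1 - w * u)).re ≤ 0 := by
  have hsq : (w.re - t) ^ 2 ≤ w.im ^ 2 := by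
    rw [← sq_abs w.im]; gcongr
  have key : ((w - t) ^ 2).re * (1 - w * u).re + ((w - t) ^ 2).im * (1 - w * u).im =
      ((w.re - t) ^ 2 - w.im ^ 2) * (1 - t * u)
        - (w.re - t) * ((w.re - t) ^ 2 + w.im ^ 2) * u := by
    simp [pow_two]
    ring
  rw [div_re, ← add_div, key]
  refine div_nonpos_of_nonpos_of_nonneg ?_ (normSq_nonneg _)
  have hA := mul_nonneg (sub_nonneg.2 hsq) htu
  have hB : 0 ≤ (w.re - t) * ((w.re - t) ^ 2 + w.im ^ 2) * u := by positivity
  linarith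

theorem re_series_nonneg (q θ : ℝ) (hq0 : 0 < q) (hq1 : q < 1) (hθ : 0 < θ) (w : ℂ)
    (hne : ∀ k : ℕ, 1 - w * (q : ℂ) ^ k ≠ 0)
    (h0 : 0 ≤ w.re - q ^ θ) (h1 : w.re - q ^ θ ≤ |w.im|) :
    0 ≤ (-fC q θ + kappaC q θ * w -
      w * ∑' k : ℕ, (q : ℂ) ^ k / (1 - w * (q : ℂ) ^ k)).re := by
  have ht1 : q ^ θ < 1 := Real.rpow_lt_one hq0.le hq1 hθ
  have ht0 : 0 < q ^ θ := Real.rpow_pos_of_pos hq0 _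
  rw [fC_eq_tsum q θ hq0 hq1 hθ, kappaC_eq_tsum q θ hq0 hq1 hθ, ← ofReal_cpow hq0.le]
  set t := q ^ θ
  have hpos (k : ℕ) : 0 < 1 - t * q ^ k := by
    have := pow_le_one₀ (n := k) hq0.le hq1.le
    nlinarith
  have s1 := (summable_pow_div_one_sub_mul_pow q hq0 hq1 t 1).hasSum
  have s2 := (summable_pow_div_one_sub_mul_pow q hq0 hq1 t 2).hasSum
  have s3 := (summable_pow_div_one_sub_mul_pow q hq0 hq1 w 1).hasSum
  simp only [pow_one] at s1 s3
  have hs := (((s2.mul_left (t : ℂ)).sub (s1.mul_left (t : ℂ))).neg.add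
    (s2.mul_right w)).sub (s3.mul_left w)
  refine (hasSum_re hs).nonneg fun k => ?_
  have hk : (1 : ℂ) - t * (q : ℂ) ^ k ≠ 0 := by exact_mod_cast (hpos k).ne'
  have hw := hne k
  have heq : -((t : ℂ) * ((q : ℂ) ^ k / (1 - t * (q : ℂ) ^ k) ^ 2) -
        t * ((q : ℂ) ^ k / (1 - t * (q : ℂ) ^ k))) +
      (q : ℂ) ^ k / (1 - t * (q : ℂ) ^ k) ^ 2 * w - w * ((q : ℂ) ^ k / (1 - w * (q : ℂ) ^ k)) =
      ((-(q ^ k / (1 - t * q ^ k)) ^ 2 : ℝ) : ℂ) *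
        ((w - t) ^ 2 / (1 - w * ((q ^ k : ℝ) : ℂ))) := by
    push_cast
    generalize (q : ℂ) ^ k = u at hk hw ⊢
    rw [mul_comm w u] at hw ⊢
    field_simp
    ring
  have hsgn := re_sq_div_nonpos (q ^ k) t w (by positivity) (hpos k).le h0 h1
  rw [heq, re_ofReal_mul]
  exact mul_nonneg_of_nonpos_of_nonpos (by simpa using sq_nonneg _) hsgn

theorem ofReal_cpow_Wc (q θ s : ℝ) (hq0 : 0 < q) (hq1 : q < 1) (hs : s ≠ 0) :
    ∃ a : ℝ, 0 < a ∧ ((q : ℂ) ^ Wc q θ s).re = q ^ θ + a ∧ |((q : ℂ) ^ Wc q θ s).im| = a := by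
  have ht0 : 0 < q ^ θ := Real.rpow_pos_of_pos hq0 _
  have hl : (Real.log q : ℂ) ≠ 0 := by exact_mod_cast (Real.log_neg hq0 hq1).ne
  have hqc : (q : ℂ) ≠ 0 := by exact_mod_cast hq0.ne'
  have ha : 0 < |s| * (√2 / 2) := by positivity
  set v : ℂ := (q : ℂ) ^ (θ : ℂ) +
    (|s| : ℝ) * Complex.exp (Complex.I * ((Real.pi / 4) * Real.sign s)) with hv
  have harg : Complex.I * (((Real.pi : ℂ) / 4) * (Real.sign s : ℂ)) =
      ((Real.pi / 4 * Real.sign s : ℝ) : ℂ) * Complex.I := by push_cast; ring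
  have hre : v.re = q ^ θ + |s| * (√2 / 2) := by
    rw [hv, harg, ← ofReal_cpow hq0.le, add_re, ofReal_re, re_ofReal_mul, exp_ofReal_mul_I_re]
    rcases hs.lt_or_gt with h | h
    · simp [Real.sign_of_neg h]
    · simp [Real.sign_of_pos h]
  have him : |v.im| = |s| * (√2 / 2) := by
    rw [hv, harg, ← ofReal_cpow hq0.le, add_im, ofReal_im, im_ofReal_mul, exp_ofReal_mul_I_im]
    rcases hs.lt_or_gt with h | h
    · simp [Real.sign_of_neg h, abs_mul, abs_div]
    · simp [Real.sign_of_pos h, abs_mul, abs_div]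
  have hv0 : v ≠ 0 := by
    intro h
    rw [h, zero_re] at hre
    linarith
  have hpow : (q : ℂ) ^ Wc q θ s = v := by
    rw [cpow_def_of_ne_zero hqc, Wc, ← ofReal_log hq0.le, mul_div_cancel₀ _ hl, exp_log hv0]
  exact ⟨_, ha, by rw [hpow, hre], by rw [hpow, him]⟩

theorem ofReal_cpow_add_ofReal (q : ℝ) (hq0 : 0 < q) (W : ℂ) (X : ℝ) :
    (q : ℂ) ^ (W + X) = ((q ^ X : ℝ) : ℂ) * (q : ℂ) ^ W := by
  rw [cpow_add _ _ (by exact_mod_cast hq0.ne'), ofReal_cpow hq0.le, mul_comm]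

theorem f0_decreasing_towards_residue (q θ : ℝ) (hq0 : 0 < q) (hq1 : q < 1) (hθ : 0 < θ)
    (s : ℝ) (j : ℕ) (hj : 1 ≤ j)
    (hre : 0 ≤ (((q : ℂ) ^ (Wc q θ s + (j : ℂ))) - (q : ℂ) ^ (θ : ℂ)).re) :
    AntitoneOn (fun X : ℝ => (f0 q θ (Wc q θ s + (X : ℂ))).re) (Set.Ioo 0 (j : ℝ))
    ∧ 0 ≤ (f0 q θ (Wc q θ s) - f0 q θ (Wc q θ s + (j : ℂ))).re := by
  have ht0 : 0 < q ^ θ := Real.rpow_pos_of_pos hq0 _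
  have hj0 : (0 : ℝ) < j := by exact_mod_cast hj
  have hcast : ((j : ℝ) : ℂ) = (j : ℂ) := by norm_cast
  rw [← hcast, sub_re, ofReal_cpow_add_ofReal q hq0, re_ofReal_mul, ← ofReal_cpow hq0.le,
    ofReal_re] at hre
  have hs : s ≠ 0 := by
    rintro rfl
    have hl : (Real.log q : ℂ) ≠ 0 := by exact_mod_cast (Real.log_neg hq0 hq1).ne
    have hW : (q : ℂ) ^ Wc q θ 0 = ((q ^ θ : ℝ) : ℂ) := by
      have h0 : ((q ^ θ : ℝ) : ℂ) ≠ 0 := by exact_mod_cast ht0.ne'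
      rw [cpow_def_of_ne_zero (by exact_mod_cast hq0.ne'), Wc, ← ofReal_log hq0.le,
        mul_div_cancel₀ _ hl, ← ofReal_cpow hq0.le]
      simp [exp_log h0]
    rw [hW, ofReal_re] at hre
    have := Real.rpow_lt_one hq0.le hq1 hj0
    nlinarith
  obtain ⟨a, ha, hWre, hWim⟩ := ofReal_cpow_Wc q θ s hq0 hq1 hs
  set W := Wc q θ s
  rw [hWre] at hre
  have hne (X : ℝ) (k : ℕ) : 1 - (q : ℂ) ^ (W + X) * (q : ℂ) ^ k ≠ 0 := by
    intro h
    have him := congrArg im h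
    rw [ofReal_cpow_add_ofReal q hq0, ← ofReal_pow, sub_im, one_im, im_mul_ofReal,
      im_ofReal_mul, zero_im, zero_sub, neg_eq_zero] at him
    have hX := Real.rpow_pos_of_pos hq0 X
    have : ((q : ℂ) ^ W).im = 0 := by simpa [hX.ne', hq0.ne'] using him
    rw [this, abs_zero] at hWim
    exact ha.ne hWim
  have hderiv (X : ℝ) := hasDerivAt_re_f0 q θ hq0 hq1 W X (hne X)
  have hanti : AntitoneOn (fun X : ℝ => (f0 q θ (W + (X : ℂ))).re) (Set.Icc 0 (j : ℝ)) := by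
    refine antitoneOn_of_deriv_nonpos (convex_Icc _ _)
      (fun X _ => (hderiv X).continuousAt.continuousWithinAt)
      (fun X _ => (hderiv X).differentiableAt.differentiableWithinAt) fun X hX => ?_
    rw [interior_Icc] at hX
    rw [(hderiv X).deriv]
    refine mul_nonpos_of_nonpos_of_nonneg (Real.log_neg hq0 hq1).le
      (re_series_nonneg q θ hq0 hq1 hθ _ (hne X) ?_ ?_)
    · have : q ^ (j : ℝ) ≤ q ^ X := Real.rpow_le_rpow_of_exponent_ge hq0 hq1.le hX.2.le
      rw [ofReal_cpow_add_ofReal q hq0, re_ofReal_mul, hWre]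
      nlinarith
    · have : q ^ X ≤ 1 := Real.rpow_le_one hq0.le hq1.le hX.1.le
      rw [ofReal_cpow_add_ofReal q hq0, re_ofReal_mul, im_ofReal_mul, abs_mul,
        abs_of_pos (Real.rpow_pos_of_pos hq0 X), hWre, hWim]
      nlinarith
  refine ⟨hanti.mono Set.Ioo_subset_Icc_self, ?_⟩
  have h := hanti ⟨le_rfl, hj0.le⟩ ⟨hj0.le, le_rfl⟩ hj0.le
  simpa [sub_re] using h
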